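/- Let [p,q] ⊆ [0,1] be an interval forecast. A path ω ∈ Ω is C-random for the stationary interval forecast [p,q] if and only if there exists a precise forecasting system φ with φ(s) ⊆ [p,q] for all s ∈ 𝕊 (i.e. compatible with [p,q]) such that ω is C-random for φ. -/

import Mathlib

open Filter Classical

/-- Situations: finite binary strings. -/
abbrev Situation := List Bool

/-- Paths: infinite binary sequences. -/
abbrev BinPath := ℕ → Bool

/-- The length-`n` prefix `ω_{1:n}` of a path. -/
def pref (ω : BinPath) (n : ℕ) : Situation := List.ofFn (fun i : Fin n => ω i)

/-- The real value of a bit. -/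
def bit (x : Bool) : ℝ := if x then 1 else 0

/-- Local expectation `E_p(f) = p f(1) + (1-p) f(0)` of a gamble `f : Bool → ℝ`. -/
def localE (p : ℝ) (f : Bool → ℝ) : ℝ := p * f true + (1 - p) * f false

/-- Upper expectation of a gamble for interval forecast `[lo, hi]`. -/
def upperE (lo hi : ℝ) (f : Bool → ℝ) : ℝ := max (localE lo f) (localE hi f)

/-- A forecasting system, given by lower and upper bounds `lo hi : Situation → ℝ`,
is proper when `0 ≤ lo s ≤ hi s ≤ 1` everywhere. -/
def IsForecastingSystem (lo hi : Situation → ℝ) : Prop :=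
  ∀ s, 0 ≤ lo s ∧ lo s ≤ hi s ∧ hi s ≤ 1

/-- The process difference `ΔF(s) : x ↦ F(s·x) − F(s)`. -/
def diffP (F : Situation → ℝ) (s : Situation) : Bool → ℝ := fun x => F (s ++ [x]) - F s

/-- A supermartingale for the forecasting system `(lo, hi)`. -/
def IsSupermartingale (lo hi : Situation → ℝ) (F : Situation → ℝ) : Prop :=
  ∀ s, upperE (lo s) (hi s) (diffP F s) ≤ 0

/-- A test supermartingale: a nonnegative supermartingale starting at 1. -/
def IsTestSupermartingale (lo hi : Situation → ℝ) (F : Situation → ℝ) : Prop :=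
  IsSupermartingale lo hi F ∧ (∀ s, 0 ≤ F s) ∧ F [] = 1

/-- A real process is (positive) rational-valued and recursive. -/
def IsRecursiveRational (F : Situation → ℝ) : Prop :=
  ∃ q : Situation → ℚ, Computable q ∧ ∀ s, (q s : ℝ) = F s

/-- A real process is computable. -/
def IsComputableProcess (F : Situation → ℝ) : Prop :=
  ∃ q : Situation → ℕ → ℚ, Computable₂ q ∧
    ∀ s n, |F s - q s n| < (2 : ℝ) ^ (-(n : ℤ))

/-- A real process is lower semicomputable. -/
def IsLSCProcess (F : Situation → ℝ) : Prop :=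
  ∃ q : Situation → ℕ → ℚ, Computable₂ q ∧
    (∀ s n, q s n ≤ q s (n + 1)) ∧
    ∀ s, Tendsto (fun m => (q s m : ℝ)) atTop (nhds (F s))

/-- A (real) growth function: computable, nonnegative, nondecreasing and unbounded. -/
def IsGrowthFunction (τ : ℕ → ℝ) : Prop :=
  (∀ n, 0 ≤ τ n) ∧ (∀ n, τ n ≤ τ (n + 1)) ∧ Tendsto τ atTop atTop ∧
    ∃ q : ℕ → ℕ → ℚ, Computable₂ q ∧ ∀ n m, |τ n - q n m| < (2 : ℝ) ^ (-(m : ℤ))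

/-- A real process is unbounded on a path: `limsup_n T(ω_{1:n}) = ∞`. -/
def UnboundedOn (T : Situation → ℝ) (ω : BinPath) : Prop :=
  limsup (fun n => ((T (pref ω n) : ℝ) : EReal)) atTop = ⊤

/-- A real process is computably unbounded on a path:
`limsup_n [T(ω_{1:n}) − τ(n)] ≥ 0` for some growth function `τ`. -/
def ComputablyUnboundedOn (T : Situation → ℝ) (ω : BinPath) : Prop :=
  ∃ τ : ℕ → ℝ, IsGrowthFunction τ ∧
    0 ≤ limsup (fun n => ((T (pref ω n) - τ n : ℝ) : EReal)) atTop

/-- Computable randomness for the forecasting system `(lo, hi)`: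
no recursive positive rational test supermartingale is unbounded on `ω`. -/
def CRandom (lo hi : Situation → ℝ) (ω : BinPath) : Prop :=
  ∀ T : Situation → ℝ, IsRecursiveRational T → (∀ s, 0 < T s) →
    IsTestSupermartingale lo hi T → ¬ UnboundedOn T ω

/-- Schnorr randomness for the forecasting system `(lo, hi)`:
no recursive positive rational test supermartingale is computably unbounded on `ω`. -/
def SchnorrRandom (lo hi : Situation → ℝ) (ω : BinPath) : Prop :=
  ∀ T : Situation → ℝ, IsRecursiveRational T → (∀ s, 0 < T s) →
    IsTestSupermartingale lo hi T → ¬ ComputablyUnboundedOn T ω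

/-- Martin-Löf randomness for the forecasting system `(lo, hi)`:
no lower semicomputable test supermartingale is unbounded on `ω`. -/
def MLRandom (lo hi : Situation → ℝ) (ω : BinPath) : Prop :=
  ∀ T : Situation → ℝ, IsLSCProcess T →
    IsTestSupermartingale lo hi T → ¬ UnboundedOn T ω

/-- A selection process is temporal if its value depends only on the length. -/
def IsTemporal (S : Situation → Bool) : Prop :=
  ∀ s t : Situation, s.length = t.length → S s = S t

/-- Value of a selection process along a path. -/
def selVal (S : Situation → Bool) (ω : BinPath) (k : ℕ) : ℝ := if S (pref ω k) then 1 else 0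

/-- `ω` is `𝒮`-random for the forecasting system `(lo, hi)`. -/
def SSetRandom (𝒮 : Set (Situation → Bool)) (lo hi : Situation → ℝ) (ω : BinPath) : Prop :=
  ∀ S ∈ 𝒮,
    Tendsto (fun n => ∑ k ∈ Finset.range n, selVal S ω k) atTop atTop →
      0 ≤ liminf (fun n =>
          (((∑ k ∈ Finset.range n, selVal S ω k * (bit (ω k) - lo (pref ω k))) /
              (∑ k ∈ Finset.range n, selVal S ω k) : ℝ) : EReal)) atTop ∧
        limsup (fun n =>
          (((∑ k ∈ Finset.range n, selVal S ω k * (bit (ω k) - hi (pref ω k))) /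
              (∑ k ∈ Finset.range n, selVal S ω k) : ℝ) : EReal)) atTop ≤ 0

/-- Weak Church randomness: the selection-process conditions hold for all
recursive temporal selection processes. -/
def WCHRandom (lo hi : Situation → ℝ) (ω : BinPath) : Prop :=
  SSetRandom {S | Computable S ∧ IsTemporal S} lo hi ω

/-- Global upper expectation of a bounded global gamble `f : BinPath → ℝ`. -/
noncomputable def globalUpperE (lo hi : Situation → ℝ) (f : BinPath → ℝ) : ℝ :=
  sInf {m : ℝ | ∃ M : Situation → ℝ, IsSupermartingale lo hi M ∧ M [] = m ∧
    ∀ ω : BinPath, (f ω : EReal) ≤ liminf (fun n => ((M (pref ω n) : ℝ) : EReal)) atTop}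

/-- Upper probability of an event. -/
noncomputable def upperProb (lo hi : Situation → ℝ) (A : Set BinPath) : ℝ :=
  globalUpperE lo hi (Set.indicator A 1)

/-- An event is almost sure if its complement has upper probability zero. -/
def AlmostSure (lo hi : Situation → ℝ) (A : Set BinPath) : Prop :=
  upperProb lo hi Aᶜ = 0

/-- The set of recursive positive rational test processes `𝓕_C`. -/
def FsetC : Set (Situation → ℝ) :=
  {F | IsRecursiveRational F ∧ (∀ s, 0 < F s) ∧ F [] = 1}

/-- The set of lower semicomputable test processes `𝓕_ML`. -/
def FsetML : Set (Situation → ℝ) :=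
  {F | IsLSCProcess F ∧ (∀ s, 0 ≤ F s) ∧ F [] = 1}

/-- The temporal selection process `S^r_F` associated with a real process `F`
and a number `r`. -/
noncomputable def selProc (r : ℝ) (F : Situation → ℝ) : Situation → Bool := fun s =>
  if ∃ t : Situation, t.length = s.length ∧ 0 < localE r (diffP F t) then true else false

/-- The set of selection processes `𝒮^{p,q}_𝓕`. -/
def SelSet (p q : ℝ) (𝓕 : Set (Situation → ℝ)) : Set (Situation → Bool) :=
  {S | ∃ F ∈ 𝓕, ∃ r ∈ ({p, q} : Set ℝ), S = selProc r F}

/-- The temporal precise forecasting system `φ^ϖ_{p,q}`. -/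
def tempFS (p q : ℝ) (ϖ : BinPath) : Situation → ℝ := fun s => if ϖ s.length then q else p

/-- A test process `F` is generated by the multiplier process `D`. -/
def GeneratedBy (D : Situation → Bool → ℝ) (F : Situation → ℝ) : Prop :=
  F [] = 1 ∧ ∀ s x, F (s ++ [x]) = F s * D s x

/-- A lower semicomputable multiplier process: a nonnegative gamble process that
is lower semicomputable. -/
def IsLSCMultiplier (D : Situation → Bool → ℝ) : Prop :=
  (∀ s x, 0 ≤ D s x) ∧
  ∃ q : Situation → Bool → ℕ → ℚ,
    Computable (fun p : Situation × Bool × ℕ => q p.1 p.2.1 p.2.2) ∧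
    (∀ s x n, q s x n ≤ q s x (n + 1)) ∧
    ∀ s x, Tendsto (fun m => (q s x m : ℝ)) atTop (nhds (D s x))

/-! ### Rational arithmetic and the encoding of ℚ -/

/-- The basic numerical code of a rational number. -/
def rcode (x : ℚ) : ℕ := @Encodable.encode ℚ Rat.instEncodable x

theorem rcode_eq (x : ℚ) : rcode x = Nat.pair (Equiv.intEquivNat x.num) x.den := rfl

theorem int_code_abs (z : ℤ) : (Equiv.intEquivNat z + 1) / 2 = z.natAbs := by
  cases z with
  | ofNat n =>
    change (2 * n + 1) / 2 = _
    simp; omega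
  | negSucc n =>
    change (2 * n + 1 + 1) / 2 = _
    simp; omega

theorem int_code_par (z : ℤ) : Equiv.intEquivNat z % 2 = if z < 0 then 1 else 0 := by
  cases z with
  | ofNat n =>
    change (2 * n) % 2 = _
    simp
  | negSucc n =>
    change (2 * n + 1) % 2 = _
    simp [Int.negSucc_lt_zero]

theorem rcode_range (n : ℕ) : n ∈ Set.range rcode ↔
    0 < n.unpair.2 ∧ ∀ i < n.unpair.2 + 1, ¬ (((n.unpair.1 + 1) / 2) % i = 0 ∧
      n.unpair.2 % i = 0 ∧ ¬ i = 1) := by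
  have key : n ∈ Set.range rcode ↔ 0 < n.unpair.2 ∧
      Nat.Coprime ((n.unpair.1 + 1) / 2) n.unpair.2 := by
    constructor
    · rintro ⟨x, rfl⟩
      rw [rcode_eq]
      simp only [Nat.unpair_pair, int_code_abs]
      exact ⟨x.pos, x.reduced⟩
    · rintro ⟨h1, h2⟩
      obtain ⟨z, hz⟩ := Equiv.intEquivNat.surjective n.unpair.1
      rw [← hz, int_code_abs] at h2
      refine ⟨⟨z, n.unpair.2, h1.ne', h2⟩, ?_⟩
      rw [rcode_eq, hz, Nat.pair_unpair]
  rw [key]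
  refine and_congr_right fun hb => ?_
  constructor
  · rintro h i _ ⟨h1, h2, h3⟩
    exact h3 (Nat.eq_one_of_dvd_coprimes h (Nat.dvd_of_mod_eq_zero h1) (Nat.dvd_of_mod_eq_zero h2))
  · intro h
    have h' := h (Nat.gcd ((n.unpair.1 + 1) / 2) n.unpair.2)
      (Nat.lt_succ_of_le (Nat.gcd_le_right _ hb))
    by_contra hc
    exact h' ⟨Nat.mod_eq_zero_of_dvd (Nat.gcd_dvd_left _ _),
      Nat.mod_eq_zero_of_dvd (Nat.gcd_dvd_right _ _), hc⟩

theorem rcode_range_primrec : PrimrecPred (fun n => n ∈ Set.range rcode) := by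
  have hR : PrimrecRel (fun (i : ℕ) (n : ℕ) => ¬ (((n.unpair.1 + 1) / 2) % i = 0 ∧
      n.unpair.2 % i = 0 ∧ ¬ i = 1)) := by
    have hi : Primrec (fun a : ℕ × ℕ => a.1) := Primrec.fst
    have hn : Primrec (fun a : ℕ × ℕ => a.2.unpair) := Primrec.unpair.comp Primrec.snd
    refine PrimrecPred.not (PrimrecPred.and ?_ (PrimrecPred.and ?_ (PrimrecPred.not ?_)))
    · exact Primrec.eq.comp (Primrec.nat_mod.comp (Primrec.nat_div.comp
        (Primrec.succ.comp (Primrec.fst.comp hn)) (Primrec.const 2)) hi) (Primrec.const 0)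
    · exact Primrec.eq.comp (Primrec.nat_mod.comp (Primrec.snd.comp hn) hi) (Primrec.const 0)
    · exact Primrec.eq.comp hi (Primrec.const 1)
  have h2 : Primrec (fun n : ℕ => n.unpair.2) := Primrec.snd.comp Primrec.unpair
  refine PrimrecPred.of_eq (PrimrecPred.and ?_ (hR.forall_lt.comp (Primrec.succ.comp h2) Primrec.id))
    (fun n => (rcode_range n).symm)
  exact Primrec.nat_lt.comp (Primrec.const 0) h2

theorem rcode_next (x : ℕ) : ∃ m, x + m + 1 ∈ Set.range rcode := by
  by_contra h
  have hfin : (Set.range rcode).Finite := by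
    refine (Set.finite_Iic x).subset fun n hn => ?_
    by_contra hlt
    simp only [Set.mem_Iic, not_le] at hlt
    exact h ⟨n - x - 1, by rwa [show x + (n - x - 1) + 1 = n by omega]⟩
  exact (Set.infinite_range_of_injective
    (@Encodable.encode_injective ℚ Rat.instEncodable)) hfin

theorem code_eq (n : ℕ): rcode (Denumerable.ofNat ℚ n) =  (@Nat.Subtype.ofNat (Set.range (@Encodable.encode ℚ Rat.instEncodable)) (Encodable.decidableRangeEncode ℚ) (Infinite.of_injective _ (Equiv.ofInjective _ Encodable.encode_injective).injective) n: ℕ) := by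
  unfold Rat.instDenumerable Denumerable.ofEncodableOfInfinite
  rw [Denumerable.ofEquiv_ofNat]
  unfold Nat.Subtype.denumerable 
  rw [Denumerable.ofEquiv_ofNat]
  rw [Denumerable.ofNat_nat]
  simp only [Equiv.coe_fn_symm_mk]
  exact congrArg Subtype.val ((Encodable.equivRangeEncode ℚ).apply_symm_apply _)

theorem code_succ (n x : ℕ) (hx : x = rcode (Denumerable.ofNat ℚ n)) :
    x + Nat.find (rcode_next x) + 1 = rcode (Denumerable.ofNat ℚ (n + 1)) := by
  rw [code_eq] at hx
  subst hx
  rw [code_eq]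
  simp only [Nat.Subtype.ofNat, Nat.Subtype.succ]
  congr!

theorem rcode_computable : Computable rcode := by
  have hfind : Computable (fun x : ℕ => Nat.find (rcode_next x)) := by
    refine Computable.find (P := fun x m => x + m + 1 ∈ Set.range rcode) ?_ rcode_next
    exact (rcode_range_primrec.comp (Primrec.succ.comp (Primrec.nat_add.comp Primrec.fst
      Primrec.snd))).computablePred
  have hstep : Computable (fun x : ℕ => x + Nat.find (rcode_next x) + 1) :=
    Computable.succ.comp (Primrec.nat_add.to_comp.comp Computable.id hfind)
  have hnat : Computable (fun n : ℕ => rcode (Denumerable.ofNat ℚ n)) := by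
    refine (Computable.nat_rec (f := fun n : ℕ => n)
      (g := fun _ => rcode (Denumerable.ofNat ℚ 0))
      (h := fun _ a => a.2 + Nat.find (rcode_next a.2) + 1) Computable.id
      (Computable.const _) ((hstep.comp (Computable.snd.comp Computable.snd)).to₂)).of_eq ?_
    intro n
    induction n with
    | zero => rfl
    | succ n ih =>
      exact code_succ n _ ih
  exact (hnat.comp Computable.encode).of_eq fun x => by
    exact congrArg rcode (Denumerable.ofNat_encode x)

theorem rat_div_iff (K : ℕ) (hK : 0 < K) (x y : ℚ) : y = x / K ↔
    (rcode y).unpair.1 % 2 = (rcode x).unpair.1 % 2 ∧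
    (((rcode y).unpair.1 + 1) / 2) * (K * (rcode x).unpair.2) =
      (((rcode x).unpair.1 + 1) / 2) * (rcode y).unpair.2 := by
  simp only [rcode_eq, Nat.unpair_pair, int_code_abs, int_code_par]
  have hKq : (0 : ℚ) < K := by exact_mod_cast hK
  have hsx : x.num < 0 ↔ x < 0 := Rat.num_neg
  have hsy : y.num < 0 ↔ y < 0 := Rat.num_neg
  have habs : y.num.natAbs * (K * x.den) = x.num.natAbs * y.den ↔ |y| * K = |x| := by
    have hx : |x| = (x.num.natAbs : ℚ) / x.den := by
      conv_lhs => rw [← Rat.num_div_den x]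
      rw [abs_div, Nat.cast_natAbs]; simp
    have hy : |y| = (y.num.natAbs : ℚ) / y.den := by
      conv_lhs => rw [← Rat.num_div_den y]
      rw [abs_div, Nat.cast_natAbs]; simp
    have h1 : (0 : ℚ) < x.den := by exact_mod_cast x.pos
    have h2 : (0 : ℚ) < y.den := by exact_mod_cast y.pos
    rw [hx, hy, div_mul_eq_mul_div, div_eq_div_iff h2.ne' h1.ne', ← @Nat.cast_inj ℚ]
    push_cast
    rw [mul_assoc]
  rw [habs, eq_div_iff hKq.ne']
  simp only [hsx, hsy]
  constructor
  · intro h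
    have : y < 0 ↔ x < 0 := by rw [← h]; constructor <;> intro h' <;> nlinarith
    refine ⟨by simp [this], by rw [← h, abs_mul, Nat.abs_cast]⟩
  · rintro ⟨h1, h2⟩
    by_cases hy : y < 0 <;> by_cases hx : x < 0 <;> simp [hy, hx] at h1
    · rw [abs_of_neg hy, abs_of_neg hx] at h2; linarith
    · rw [abs_of_nonneg (not_lt.1 hy), abs_of_nonneg (not_lt.1 hx)] at h2; linarith

theorem rat_div_computable (K : ℕ) (hK : 0 < K) : Computable (fun x : ℚ => x / K) := by
  let Q : ℕ × ℕ → Prop := fun a => a.2.unpair.1 % 2 = a.1.unpair.1 % 2 ∧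
    ((a.2.unpair.1 + 1) / 2) * (K * a.1.unpair.2) = ((a.1.unpair.1 + 1) / 2) * a.2.unpair.2
  have hQ : PrimrecPred Q := by
    have hx : Primrec (fun a : ℕ × ℕ => a.1.unpair) := Primrec.unpair.comp Primrec.fst
    have hy : Primrec (fun a : ℕ × ℕ => a.2.unpair) := Primrec.unpair.comp Primrec.snd
    refine PrimrecPred.and ?_ ?_
    · exact Primrec.eq.comp (Primrec.nat_mod.comp (Primrec.fst.comp hy) (Primrec.const 2))
        (Primrec.nat_mod.comp (Primrec.fst.comp hx) (Primrec.const 2))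
    · exact Primrec.eq.comp
        (Primrec.nat_mul.comp (Primrec.nat_div.comp (Primrec.succ.comp (Primrec.fst.comp hy))
          (Primrec.const 2)) (Primrec.nat_mul.comp (Primrec.const K) (Primrec.snd.comp hx)))
        (Primrec.nat_mul.comp (Primrec.nat_div.comp (Primrec.succ.comp (Primrec.fst.comp hx))
          (Primrec.const 2)) (Primrec.snd.comp hy))
  have hex : ∀ x : ℚ, ∃ m : ℕ, Q (rcode x, rcode (Denumerable.ofNat ℚ m)) := fun x =>
    ⟨@Encodable.encode ℚ Rat.instDenumerable.toEncodable (x / K), by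
      rw [Denumerable.ofNat_encode]; exact (rat_div_iff K hK x _).1 rfl⟩
  have hfind : Computable (fun x : ℚ => Nat.find (hex x)) := by
    refine Computable.find (P := fun (x : ℚ) m => Q (rcode x, rcode (Denumerable.ofNat ℚ m))) ?_ hex
    have hdec := hQ.computablePred.decide
    refine Computable.computablePred (hdec.comp (Computable.pair
      (rcode_computable.comp Computable.fst)
      (rcode_computable.comp ((Computable.ofNat ℚ).comp Computable.snd))))
  refine ((Computable.ofNat ℚ).comp hfind).of_eq fun x => ?_
  exact (rat_div_iff K hK x _).2 (Nat.find_spec (hex x))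

/-! ### Countability of the computable processes -/

theorem exists_enum : ∃ F : ℕ → Situation → ℚ, ∀ q : Situation → ℚ, Computable q →
    ∃ k, F k = q := by
  have hc : {q : Situation → ℚ | Computable q}.Countable := by
    have hcode : ∀ q : {q : Situation → ℚ | Computable q}, ∃ c : Nat.Partrec.Code,
        c.eval = fun n => Part.bind (Encodable.decode (α := Situation) n)
          fun a => ((q.1 : Situation →. ℚ) a).map
            (@Encodable.encode ℚ Rat.instDenumerable.toEncodable) := by
      rintro ⟨q, hq⟩
      exact Nat.Partrec.Code.exists_code.1 hq
    choose c hc using hcode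
    refine Set.countable_coe_iff.1 (Function.Injective.countable (f := c) ?_)
    intro a b hab
    have h := (hc a).symm.trans ((congrArg Nat.Partrec.Code.eval hab).trans (hc b))
    apply Subtype.ext
    funext s
    have h2 := congrFun h (Encodable.encode s)
    simp only [Encodable.encodek, Part.coe_some, Part.bind_some, PFun.coe_val,
      Part.map_some, Part.some_inj] at h2
    exact @Encodable.encode_injective ℚ Rat.instDenumerable.toEncodable _ _ h2
  have hne : {q : Situation → ℚ | Computable q}.Nonempty := ⟨fun _ => 0, Computable.const 0⟩
  obtain ⟨F, hF⟩ := hc.exists_eq_range hne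
  refine ⟨F, fun q hq => ?_⟩
  have : q ∈ Set.range F := hF ▸ hq
  exact this

/-- A sequence of infinite sets has an injective choice function. -/
theorem exists_injective_choice {α : Type*} (A : ℕ → Set α) (hA : ∀ n, (A n).Infinite) :
    ∃ s : ℕ → α, Function.Injective s ∧ ∀ n, s n ∈ A n := by
  have hpick : ∀ (n : ℕ) (L : List α), ∃ a, a ∈ A n ∧ a ∉ L := by
    intro n L
    obtain ⟨a, ha, hL⟩ := (hA n).exists_notMem_finset L.toFinset
    exact ⟨a, ha, by simpa using hL⟩
  choose pick h1 h2 using hpick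
  let g : ℕ → List α := fun n => Nat.rec [] (fun n L => pick n L :: L) n
  have hg : ∀ n, g (n + 1) = pick n (g n) :: g n := fun n => rfl
  have hmem : ∀ m n, m < n → pick m (g m) ∈ g n := by
    intro m n hmn
    induction n with
    | zero => omega
    | succ n ih =>
      rw [hg]
      rcases Nat.lt_succ_iff_lt_or_eq.1 hmn with h | h
      · exact List.mem_cons_of_mem _ (ih h)
      · subst h; exact List.mem_cons_self
  refine ⟨fun n => pick n (g n), ?_, fun n => h1 _ _⟩
  intro m n hmn
  change pick m (g m) = pick n (g n) at hmn
  rcases lt_trichotomy m n with h | h | h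
  · exact absurd (hmn ▸ hmem m n h) (h2 n (g n))
  · exact h
  · exact absurd (hmn.symm ▸ hmem n m h) (h2 m (g m))

theorem unboundedOn_iff (T : Situation → ℝ) (ω : BinPath) :
    UnboundedOn T ω ↔ ∀ b : ℝ, ∃ᶠ n in atTop, b < T (pref ω n) := by
  unfold UnboundedOn
  constructor
  · intro h b
    have hb : (b : EReal) < limsup (fun n => ((T (pref ω n) : ℝ) : EReal)) atTop := by
      rw [h]; exact EReal.coe_lt_top b
    exact (frequently_lt_of_lt_limsup (by isBoundedDefault) hb).mono
      fun n hn => EReal.coe_lt_coe_iff.1 hn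
  · intro h
    rw [EReal.eq_top_iff_forall_lt]
    intro b
    have h1 : ((b + 1 : ℝ) : EReal) ≤ limsup (fun n => ((T (pref ω n) : ℝ) : EReal)) atTop :=
      le_limsup_of_frequently_le ((h (b + 1)).mono
        fun n hn => EReal.coe_le_coe_iff.2 hn.le) (by isBoundedDefault)
    exact lt_of_lt_of_le (EReal.coe_lt_coe_iff.2 (by linarith)) h1

theorem bounded_of_finite_violations (p q : ℝ) (h0 : 0 ≤ p) (hpq : p ≤ q) (h1 : q ≤ 1)
    (ω : BinPath) (hω : CRandom (fun _ => p) (fun _ => q) ω) (T : Situation → ℝ)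
    (hT : IsRecursiveRational T) (hpos : ∀ s, 0 < T s)
    (hfin : {s : Situation | 0 < upperE p q (diffP T s)}.Finite) : ¬ UnboundedOn T ω := by
  intro hU
  obtain ⟨M, hM⟩ := (hfin.image List.length).bddAbove
  obtain ⟨C, hC⟩ := ((List.finite_length_eq Bool (M + 1)).image T).bddAbove
  obtain ⟨K, hK⟩ := exists_nat_gt (max C 0)
  have hK0 : (0 : ℝ) < K := lt_of_le_of_lt (le_max_right _ _) hK
  have hKn : 0 < K := by exact_mod_cast hK0
  let T' : Situation → ℝ := fun s => if s.length < M + 1 then 1 else T s / K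
  refine hω T' ?_ ?_ ⟨?_, ?_, ?_⟩ ?_
  · obtain ⟨f, hf, hfT⟩ := hT
    refine ⟨fun s => bif decide (s.length < M + 1) then 1 else f s / K, ?_, ?_⟩
    · refine Computable.cond ?_ (Computable.const 1) ((rat_div_computable K hKn).comp hf)
      exact ((Primrec.nat_lt.comp Primrec.list_length
        (Primrec.const (M + 1))).computablePred).decide
    · intro s
      by_cases h : s.length < M + 1
      · simp only [T', h, decide_true, cond_true, if_true, Rat.cast_one]
      · simp only [T', h, decide_false, cond_false, if_false, Rat.cast_div, Rat.cast_natCast, hfT]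
  · intro s
    by_cases h : s.length < M + 1
    · simp only [T', h, if_true]; exact one_pos
    · simp only [T', h, if_false]; exact div_pos (hpos s) hK0
  · intro s
    have hle : ∀ r, 0 ≤ r → r ≤ 1 → (M < s.length → localE r (diffP T s) ≤ 0) →
        localE r (diffP T' s) ≤ 0 := by
      intro r hr0 hr1 hr
      rcases lt_trichotomy s.length M with h | h | h
      · simp only [localE, diffP, T', List.length_append, List.length_singleton,
          show s.length + 1 < M + 1 by omega, show s.length < M + 1 by omega, if_true]
        linarith
      · have hx : ∀ x, T (s ++ [x]) / K ≤ 1 := by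
          intro x
          rw [div_le_one hK0]
          have : T (s ++ [x]) ≤ C := hC ⟨s ++ [x], by simp [h], rfl⟩
          exact this.trans ((le_max_left _ _).trans hK.le)
        have ht := hx true
        have hf := hx false
        simp only [localE, diffP, T', List.length_append, List.length_singleton, h, lt_irrefl,
          if_false, Nat.lt_succ_self, if_true]
        nlinarith
      · have := hr h
        have e : localE r (diffP T' s) = localE r (diffP T s) / K := by
          simp only [localE, diffP, T', List.length_append, List.length_singleton,
            show ¬ s.length + 1 < M + 1 by omega, show ¬ s.length < M + 1 by omega, if_false]
          ring
        rw [e]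
        exact div_nonpos_of_nonpos_of_nonneg this hK0.le
    have hup : M < s.length → upperE p q (diffP T s) ≤ 0 := by
      intro h
      by_contra hc
      have : s.length ≤ M := hM ⟨s, not_le.1 hc, rfl⟩
      omega
    exact max_le (hle p h0 (hpq.trans h1) fun h => (le_max_left _ _).trans (hup h))
      (hle q (h0.trans hpq) h1 fun h => (le_max_right _ _).trans (hup h))
  · intro s
    by_cases h : s.length < M + 1
    · simp only [T', h, if_true]; exact zero_le_one
    · simp only [T', h, if_false]; exact (div_pos (hpos s) hK0).le
  · simp [T']
  · rw [unboundedOn_iff] at hU ⊢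
    intro b
    refine ((hU (b * K)).and_eventually (eventually_ge_atTop (M + 1))).mono ?_
    rintro n ⟨hn, hnM⟩
    have hl : (pref ω n).length = n := by simp [pref]
    simp only [T', hl, show ¬ n < M + 1 by omega, if_false]
    rwa [lt_div_iff₀ hK0]

/-- `ω` is C-random for the stationary interval forecast `[p,q]`
iff it is C-random for some compatible precise forecasting system. -/
theorem statement_5 (p q : ℝ) (h0 : 0 ≤ p) (hpq : p ≤ q) (h1 : q ≤ 1) (ω : BinPath) :
    CRandom (fun _ => p) (fun _ => q) ω ↔
      ∃ φ : Situation → ℝ, (∀ s, p ≤ φ s ∧ φ s ≤ q) ∧ CRandom φ φ ω := by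
  constructor
  · intro hω
    obtain ⟨F, hF⟩ := exists_enum
    let B : ℕ → Set Situation := fun k =>
      {s | 0 < upperE p q (diffP (fun s => (F k s : ℝ)) s)}
    obtain ⟨s, hinj, hs⟩ := exists_injective_choice
      (fun k => if (B k).Infinite then B k else Set.univ) (by
        intro k
        by_cases h : (B k).Infinite
        · simp [h]
        · simp only [h, if_false]; exact Set.infinite_univ)
    let r : ℕ → ℝ := fun k =>
      if 0 < localE p (diffP (fun s => (F k s : ℝ)) (s k)) then p else q
    have hr : ∀ k, p ≤ r k ∧ r k ≤ q := by
      intro k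
      by_cases h : 0 < localE p (diffP (fun s => (F k s : ℝ)) (s k))
      · simp only [r, h, if_true]; exact ⟨le_refl _, hpq⟩
      · simp only [r, h, if_false]; exact ⟨hpq, le_refl _⟩
    refine ⟨Function.extend s r (fun _ => p), ?_, ?_⟩
    · intro t
      by_cases h : ∃ k, s k = t
      · obtain ⟨k, rfl⟩ := h
        rw [hinj.extend_apply]; exact hr k
      · rw [Function.extend_apply' _ _ _ h]; exact ⟨le_refl _, hpq⟩
    · intro T hT hpos hsup
      obtain ⟨f, hf, hfT⟩ := id hT
      obtain ⟨k, hk⟩ := hF f hf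
      have hTk : (fun s => (F k s : ℝ)) = T := by funext t; rw [hk, hfT]
      by_cases h : (B k).Infinite
      · exfalso
        have hmem : s k ∈ B k := by
          have := hs k
          simpa only [h, if_true] using this
        have h3 := hsup.1 (s k)
        rw [hinj.extend_apply] at h3
        have h4 : 0 < upperE p q (diffP T (s k)) := by rw [← hTk]; exact hmem
        have h5 : localE (r k) (diffP T (s k)) ≤ 0 := (le_max_left _ _).trans h3
        by_cases h6 : 0 < localE p (diffP T (s k))
        · simp only [r, hTk, h6, if_true] at h5
          linarith
        · simp only [r, hTk, h6, if_false] at h5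
          exact absurd (max_le (not_lt.1 h6) h5) (not_le.2 h4)
      · refine bounded_of_finite_violations p q h0 hpq h1 ω hω T hT hpos ?_
        have := Set.not_infinite.1 h
        simpa only [B, hTk] using this
  · rintro ⟨φ, hφ, hR⟩ T hT hpos hsup
    refine hR T hT hpos ⟨fun s => ?_, hsup.2⟩
    have h := hsup.1 s
    have hp : localE p (diffP T s) ≤ 0 := (le_max_left _ _).trans h
    have hq : localE q (diffP T s) ≤ 0 := (le_max_right _ _).trans h
    obtain ⟨ha, hb⟩ := hφ s
    refine max_le ?_ ?_ <;>
    · simp only [localE] at hp hq ⊢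
      rcases le_total (diffP T s true) (diffP T s false) with hd | hd
      · nlinarith
      · nlinarith
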